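/- If Θ < 1, Ω > 1 and Γ < 1, then f₁ ∈ Lip δ with δ = min( log α / log |I_min|, μ ), i.e. there exists C > 0 such that |f₁(x) − f₁(y)| ≤ C|x − y|^δ for all x, y ∈ [0,1]. -/

import Mathlib

/-- Minimum of `g i` over `i = 1, …, N`. -/
noncomputable def minOver (N : ℕ) (g : ℕ → ℝ) : ℝ := sInf (g '' Set.Icc 1 N)

/-- Maximum of `g i` over `i = 1, …, N`. -/
noncomputable def maxOver (N : ℕ) (g : ℕ → ℝ) : ℝ := sSup (g '' Set.Icc 1 N)

lemma exists_eq_maxOver {N : ℕ} (hN : 1 ≤ N) (g : ℕ → ℝ) :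
    ∃ i ∈ Set.Icc 1 N, maxOver N g = g i := by
  have hne : (g '' Set.Icc 1 N).Nonempty := ⟨g 1, 1, ⟨le_rfl, hN⟩, rfl⟩
  obtain ⟨i, hi, h⟩ := hne.csSup_mem ((Set.finite_Icc 1 N).image g)
  exact ⟨i, hi, h.symm⟩

lemma le_maxOver {N : ℕ} (g : ℕ → ℝ) {i : ℕ} (hi : i ∈ Set.Icc 1 N) : g i ≤ maxOver N g :=
  le_csSup ((Set.finite_Icc 1 N).image g).bddAbove ⟨i, hi, rfl⟩

lemma exists_eq_minOver {N : ℕ} (hN : 1 ≤ N) (g : ℕ → ℝ) :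
    ∃ i ∈ Set.Icc 1 N, minOver N g = g i := by
  have hne : (g '' Set.Icc 1 N).Nonempty := ⟨g 1, 1, ⟨le_rfl, hN⟩, rfl⟩
  obtain ⟨i, hi, h⟩ := hne.csInf_mem ((Set.finite_Icc 1 N).image g)
  exact ⟨i, hi, h.symm⟩

lemma minOver_le {N : ℕ} (g : ℕ → ℝ) {i : ℕ} (hi : i ∈ Set.Icc 1 N) : minOver N g ≤ g i :=
  csInf_le ((Set.finite_Icc 1 N).image g).bddBelow ⟨i, hi, rfl⟩

/-- A Hölder bound with exponent `ν` propagates along a relation `S` on pairs of points of `[0, 1]`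
when each pair either satisfies a bound with constant at most `C`, or is the image of a pair in `S`
under a map contracting distances by at least `ρ < 1` that preserves the bound with constant `C`. -/
lemma holder_bound_of_descent {g : ℝ → ℝ} {ν ρ C : ℝ} (hρ : ρ < 1) (hC : 0 ≤ C)
    {S : ℝ → ℝ → Prop} (hS1 : ∀ s t, S s t → |s - t| ≤ 1)
    (hS : ∀ s t, S s t → |g s - g t| ≤ C * |s - t| ^ ν ∨ ∃ s' t', S s' t' ∧
      |s - t| ≤ ρ * |s' - t'| ∧
      (|g s' - g t'| ≤ C * |s' - t'| ^ ν → |g s - g t| ≤ C * |s - t| ^ ν))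
    {s t : ℝ} (hst : S s t) : |g s - g t| ≤ C * |s - t| ^ ν := by
  rcases eq_or_ne s t with rfl | hne
  · rw [sub_self (g s), abs_zero]
    positivity
  have hpos : 0 < |s - t| := abs_pos.mpr (sub_ne_zero.mpr hne)
  rcases hS s t hst with h | ⟨s₁, t₁, -, hd₁, -⟩
  · exact h
  have hρ0 : 0 < ρ := pos_of_mul_pos_left (hpos.trans_le hd₁) (abs_nonneg _)
  have key : ∀ n : ℕ, ∀ s t, S s t → ρ ^ n < |s - t| → |g s - g t| ≤ C * |s - t| ^ ν := by
    intro n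
    induction n with
    | zero =>
      intro s t h hlt
      have := hS1 s t h
      rw [pow_zero] at hlt
      linarith
    | succ n ih =>
      intro s t h hlt
      rcases hS s t h with h | ⟨s', t', h', hd, himp⟩
      · exact h
      · refine himp (ih s' t' h' ?_)
        rw [pow_succ'] at hlt
        exact lt_of_mul_lt_mul_left (hlt.trans_le hd) hρ0.le
  obtain ⟨n, hn⟩ := exists_pow_lt_of_lt_one hpos hρ
  exact key n s t hst hn

/-- A continuous solution of the self-affine equations `g (L i t) = a i * g t + r i t` on `[0, 1]`
is Hölder of exponent `ν` if all `r i` are and `max |a i| / |I i| ^ ν < 1`. -/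
lemma holder_of_self_affine {N : ℕ} (hN : 2 ≤ N) {x : ℕ → ℝ} (hx0 : x 0 = 0) (hxN : x N = 1)
    (hxmono : ∀ i < N, x i < x (i + 1)) {a : ℕ → ℝ} {r : ℕ → ℝ → ℝ} {ν : ℝ} (hν : 0 < ν)
    (hr : ∀ i ∈ Set.Icc 1 N, ∃ M > 0, ∀ s ∈ Set.Icc (0 : ℝ) 1, ∀ t ∈ Set.Icc (0 : ℝ) 1,
      |r i s - r i t| ≤ M * |s - t| ^ ν)
    {g : ℝ → ℝ} (hg : ContinuousOn g (Set.Icc 0 1))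
    (heq : ∀ i ∈ Set.Icc 1 N, ∀ t ∈ Set.Icc (0 : ℝ) 1,
      g ((x i - x (i - 1)) * t + x (i - 1)) = a i * g t + r i t)
    (ha : maxOver N (fun i => |a i| / (x i - x (i - 1)) ^ ν) < 1) :
    ∃ C > 0, ∀ s ∈ Set.Icc (0 : ℝ) 1, ∀ t ∈ Set.Icc (0 : ℝ) 1,
      |g s - g t| ≤ C * |s - t| ^ ν := by
  have hN1 : 1 ≤ N := by omega
  have hlen : ∀ i ∈ Set.Icc 1 N, 0 < x i - x (i - 1) := by
    rintro i ⟨h1, h2⟩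
    have := hxmono (i - 1) (by omega)
    rw [Nat.sub_add_cancel h1] at this
    linarith
  have hmono : ∀ j ≤ N, ∀ i < j, x i < x j := by
    intro j hj
    induction j with
    | zero => intro i hi; omega
    | succ j ih =>
      intro i hi
      rcases Nat.lt_succ_iff_lt_or_eq.mp hi with h | rfl
      · exact (ih (by omega) i h).trans (hxmono j (by omega))
      · exact hxmono i (by omega)
  have hx_le_one : ∀ i ≤ N, x i ≤ 1 := by
    intro i hi
    rcases hi.eq_or_lt with rfl | h
    · exact hxN.le
    · exact hxN ▸ (hmono N le_rfl i h).le
  obtain ⟨k, hk, hkm⟩ := exists_eq_minOver hN1 (fun i => x i - x (i - 1))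
  obtain ⟨l, hl, hlm⟩ := exists_eq_maxOver hN1 (fun i => x i - x (i - 1))
  set m := minOver N (fun i => x i - x (i - 1))
  set ρ := maxOver N (fun i => x i - x (i - 1))
  have hm : 0 < m := hkm ▸ hlen k hk
  have hm_le : ∀ i ∈ Set.Icc 1 N, m ≤ x i - x (i - 1) :=
    fun i hi => minOver_le (fun i => x i - x (i - 1)) hi
  have hle_ρ : ∀ i ∈ Set.Icc 1 N, x i - x (i - 1) ≤ ρ :=
    fun i hi => le_maxOver (fun i => x i - x (i - 1)) hi
  have hρ : ρ < 1 := by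
    rw [hlm]
    obtain ⟨h1, h2⟩ := hl
    rcases h1.eq_or_lt with h | h
    · have := hmono N le_rfl 1 (by omega)
      subst h
      simp only [Nat.sub_self]
      linarith
    · have h3 := hmono (l - 1) (by omega) 0 (by omega)
      have h4 := hx_le_one l h2
      linarith
  set θ := maxOver N (fun i => |a i| / (x i - x (i - 1)) ^ ν)
  have haθ : ∀ i ∈ Set.Icc 1 N, |a i| ≤ θ * (x i - x (i - 1)) ^ ν := by
    intro i hi
    rw [← div_le_iff₀ (Real.rpow_pos_of_pos (hlen i hi) ν)]
    exact le_maxOver (fun i => |a i| / (x i - x (i - 1)) ^ ν) hi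
  choose! M hM0 hM using hr
  set K := maxOver N M / m ^ ν with hK_def
  have hmν : 0 < m ^ ν := Real.rpow_pos_of_pos hm ν
  have hMmax : 0 < maxOver N M := (hM0 1 ⟨le_rfl, hN1⟩).trans_le (le_maxOver M ⟨le_rfl, hN1⟩)
  have hK : 0 < K := div_pos hMmax hmν
  have hstep : ∀ C, K / (1 - θ) ≤ C → ∀ i ∈ Set.Icc 1 N, ∀ s ∈ Set.Icc (0 : ℝ) 1,
      ∀ t ∈ Set.Icc (0 : ℝ) 1, |g s - g t| ≤ C * |s - t| ^ ν →
      |g ((x i - x (i - 1)) * s + x (i - 1)) - g ((x i - x (i - 1)) * t + x (i - 1))| ≤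
        C * |((x i - x (i - 1)) * s + x (i - 1)) - ((x i - x (i - 1)) * t + x (i - 1))| ^ ν := by
    intro C hC i hi s hs t ht h
    have hli := hlen i hi
    have hd : |((x i - x (i - 1)) * s + x (i - 1)) - ((x i - x (i - 1)) * t + x (i - 1))| ^ ν
        = (x i - x (i - 1)) ^ ν * |s - t| ^ ν := by
      rw [← Real.mul_rpow hli.le (abs_nonneg _), ← abs_of_pos hli, ← abs_mul, abs_of_pos hli]
      congr 2
      ring
    rw [hd, heq i hi s hs, heq i hi t ht]
    set D := |s - t| ^ ν
    have hD : 0 ≤ D := Real.rpow_nonneg (abs_nonneg _) _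
    set ℓ := (x i - x (i - 1)) ^ ν
    have hmℓ : m ^ ν ≤ ℓ := Real.rpow_le_rpow hm.le (hm_le i hi) hν.le
    have hCθ : θ * C + K ≤ C := by
      rw [div_le_iff₀ (by linarith)] at hC
      linarith
    have hMK : M i ≤ K * ℓ := by
      calc M i ≤ maxOver N M := le_maxOver M hi
        _ = K * m ^ ν := by rw [hK_def, div_mul_cancel₀ _ hmν.ne']
        _ ≤ K * ℓ := by gcongr
    calc |a i * g s + r i s - (a i * g t + r i t)|
        = |a i * (g s - g t) + (r i s - r i t)| := by congr 1; ring
      _ ≤ |a i| * |g s - g t| + |r i s - r i t| := by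
        rw [← abs_mul]; exact abs_add_le _ _
      _ ≤ (θ * ℓ) * (C * D) + (K * ℓ) * D := by
        refine add_le_add (mul_le_mul (haθ i hi) h (abs_nonneg _)
          ((abs_nonneg _).trans (haθ i hi))) ((hM i hi s hs t ht).trans ?_)
        gcongr
      _ = (θ * C + K) * (ℓ * D) := by ring
      _ ≤ C * (ℓ * D) := by gcongr
  obtain ⟨G, hG⟩ := isCompact_Icc.exists_bound_of_continuousOn hg
  have hG0 : 0 ≤ G := (norm_nonneg _).trans (hG 0 ⟨le_rfl, zero_le_one⟩)
  have hKθ : 0 < K / (1 - θ) := div_pos hK (by linarith)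
  set C₀ := 2 * G / m ^ ν + K / (1 - θ)
  have hfar0 : 0 ≤ 2 * G / m ^ ν := by positivity
  have hC₀ : 0 < C₀ := by positivity
  have hC₀K : K / (1 - θ) ≤ C₀ := by linarith
  have hfar : ∀ s ∈ Set.Icc (0 : ℝ) 1, ∀ t ∈ Set.Icc (0 : ℝ) 1, m ≤ |s - t| →
      |g s - g t| ≤ C₀ * |s - t| ^ ν := by
    intro s hs t ht h
    have h1 : |g s| ≤ G := hG s hs
    have h2 : |g t| ≤ G := hG t ht
    calc |g s - g t| ≤ |g s| + |g t| := abs_sub _ _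
      _ ≤ 2 * G / m ^ ν * m ^ ν := by rw [div_mul_cancel₀ _ hmν.ne']; linarith
      _ ≤ C₀ * |s - t| ^ ν :=
        mul_le_mul (by linarith) (Real.rpow_le_rpow hm.le h hν.le) hmν.le hC₀.le
  have hinv : ∀ i ∈ Set.Icc 1 N, ∀ s ∈ Set.Icc (x (i - 1)) (x i), ∃ s' ∈ Set.Icc (0 : ℝ) 1,
      s = (x i - x (i - 1)) * s' + x (i - 1) := by
    intro i hi s hs
    have hli := hlen i hi
    refine ⟨(s - x (i - 1)) / (x i - x (i - 1)),
      ⟨div_nonneg (by linarith [hs.1]) hli.le, (div_le_one hli).mpr (by linarith [hs.2])⟩, ?_⟩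
    field_simp
    ring
  have hcontr : ∀ i ∈ Set.Icc 1 N, ∀ s t : ℝ,
      |((x i - x (i - 1)) * s + x (i - 1)) - ((x i - x (i - 1)) * t + x (i - 1))|
        ≤ ρ * |s - t| := by
    intro i hi s t
    rw [add_sub_add_right_eq_sub, ← mul_sub, abs_mul, abs_of_pos (hlen i hi)]
    exact mul_le_mul_of_nonneg_right (hle_ρ i hi) (abs_nonneg _)
  have hdist : ∀ s ∈ Set.Icc (0 : ℝ) 1, ∀ t ∈ Set.Icc (0 : ℝ) 1, |s - t| ≤ 1 := by
    intro s hs t ht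
    rw [abs_le]
    constructor <;> linarith [hs.1, hs.2, ht.1, ht.2]
  have h0mem : (0 : ℝ) ∈ Set.Icc (0 : ℝ) 1 := ⟨le_rfl, zero_le_one⟩
  have h1mem : (1 : ℝ) ∈ Set.Icc (0 : ℝ) 1 := ⟨zero_le_one, le_rfl⟩
  have hleft : ∀ t ∈ Set.Icc (0 : ℝ) 1, |g 0 - g t| ≤ C₀ * |0 - t| ^ ν := by
    intro t ht
    refine holder_bound_of_descent (S := fun s t => s = 0 ∧ t ∈ Set.Icc (0 : ℝ) 1) hρ hC₀.le
      ?_ ?_ ⟨rfl, ht⟩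
    · rintro s t ⟨rfl, ht⟩
      exact hdist 0 h0mem t ht
    · rintro s t ⟨rfl, ht⟩
      have hi : 1 ∈ Set.Icc 1 N := ⟨le_rfl, hN1⟩
      have hb : x (1 - 1) = 0 := hx0
      rcases le_or_gt t (x 1) with h | h
      · right
        obtain ⟨t', ht', rfl⟩ := hinv 1 hi t ⟨by rw [hb]; exact ht.1, h⟩
        have e : (0 : ℝ) = (x 1 - x (1 - 1)) * 0 + x (1 - 1) := by rw [hb]; ring
        have h2 := hcontr 1 hi 0 t'
        have h3 := hstep C₀ hC₀K 1 hi 0 h0mem t' ht'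
        rw [← e] at h2 h3
        exact ⟨0, t', ⟨rfl, ht'⟩, h2, h3⟩
      · left
        refine hfar 0 h0mem t ht ?_
        have := hm_le 1 hi
        rw [hb] at this
        rw [zero_sub, abs_neg]
        exact le_trans (by linarith) (le_abs_self t)
  have hright : ∀ s ∈ Set.Icc (0 : ℝ) 1, |g s - g 1| ≤ C₀ * |s - 1| ^ ν := by
    intro s hs
    refine holder_bound_of_descent (S := fun s t => s ∈ Set.Icc (0 : ℝ) 1 ∧ t = 1) hρ hC₀.le
      ?_ ?_ ⟨hs, rfl⟩
    · rintro s t ⟨hs, rfl⟩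
      exact hdist s hs 1 h1mem
    · rintro s t ⟨hs, rfl⟩
      have hi : N ∈ Set.Icc 1 N := ⟨hN1, le_rfl⟩
      rcases le_or_gt (x (N - 1)) s with h | h
      · right
        obtain ⟨s', hs', rfl⟩ := hinv N hi s ⟨h, by rw [hxN]; exact hs.2⟩
        have e : (1 : ℝ) = (x N - x (N - 1)) * 1 + x (N - 1) := by rw [hxN]; ring
        have h2 := hcontr N hi s' 1
        have h3 := hstep C₀ hC₀K N hi s' hs' 1 h1mem
        rw [← e] at h2 h3
        exact ⟨s', 1, ⟨hs', rfl⟩, h2, h3⟩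
      · left
        refine hfar s hs 1 h1mem ?_
        have := hm_le N hi
        rw [hxN] at this
        rw [abs_sub_comm]
        exact le_trans (by linarith) (le_abs_self _)
  have hlt : ∀ s t : ℝ, s ∈ Set.Icc (0 : ℝ) 1 ∧ t ∈ Set.Icc (0 : ℝ) 1 ∧ s ≤ t →
      |g s - g t| ≤ (2 * C₀) * |s - t| ^ ν := by
    intro s t hst
    refine holder_bound_of_descent
      (S := fun s t => s ∈ Set.Icc (0 : ℝ) 1 ∧ t ∈ Set.Icc (0 : ℝ) 1 ∧ s ≤ t) hρ
      (by positivity) (fun s t h => hdist s h.1 t h.2.1) ?_ hst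
    rintro s t ⟨hs, ht, hle⟩
    rcases hle.eq_or_lt with rfl | hlt
    · left
      rw [sub_self (g s), abs_zero]
      positivity
    have hex : ∃ i, s < x i := ⟨N, by rw [hxN]; linarith [ht.2]⟩
    obtain ⟨i, hsi, hmin⟩ : ∃ i, s < x i ∧ ∀ j < i, ¬ s < x j :=
      ⟨Nat.find hex, Nat.find_spec hex, fun j hj => Nat.find_min hex hj⟩
    have hiN : i ≤ N := by
      by_contra! h
      exact hmin N h (by rw [hxN]; linarith [ht.2])
    have hi1 : 1 ≤ i := by
      rcases Nat.eq_zero_or_pos i with rfl | h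
      · rw [hx0] at hsi
        linarith [hs.1]
      · exact h
    have hi : i ∈ Set.Icc 1 N := ⟨hi1, hiN⟩
    have hsi' : x (i - 1) ≤ s := not_lt.mp (hmin (i - 1) (by omega))
    obtain ⟨s', hs', hss'⟩ := hinv i hi s ⟨hsi', hsi.le⟩
    rcases le_or_gt t (x i) with hti | hti
    · right
      obtain ⟨t', ht', htt'⟩ := hinv i hi t ⟨by linarith, hti⟩
      have h2 := hcontr i hi s' t'
      have h3 := hstep (2 * C₀) (by linarith) i hi s' hs' t' ht'
      rw [← hss', ← htt'] at h2 h3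
      refine ⟨s', t', ⟨hs', ht', ?_⟩, h2, h3⟩
      refine le_of_mul_le_mul_left (a := x i - x (i - 1)) ?_ (hlen i hi)
      linarith
    · left
      have hiN' : i < N := by
        refine lt_of_le_of_ne hiN ?_
        rintro rfl
        linarith [ht.2]
      have hj : i + 1 ∈ Set.Icc 1 N := ⟨by omega, hiN'⟩
      rcases le_or_gt t (x (i + 1)) with htj | htj
      · obtain ⟨t', ht', htt'⟩ := hinv (i + 1) hj t ⟨hti.le, htj⟩
        have e1 : x i = (x i - x (i - 1)) * 1 + x (i - 1) := by ring
        have e2 : x i = (x (i + 1) - x (i + 1 - 1)) * 0 + x (i + 1 - 1) := by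
          rw [Nat.add_sub_cancel]; ring
        have h2 := hstep C₀ hC₀K i hi s' hs' 1 h1mem (hright s' hs')
        have h3 := hstep C₀ hC₀K (i + 1) hj 0 h0mem t' ht' (hleft t' ht')
        rw [← hss', ← e1] at h2
        rw [← htt', ← e2] at h3
        have h4 : |s - x i| ^ ν ≤ |s - t| ^ ν := by
          refine Real.rpow_le_rpow (abs_nonneg _) ?_ hν.le
          rw [abs_of_neg (by linarith), abs_of_neg (by linarith)]
          linarith
        have h5 : |x i - t| ^ ν ≤ |s - t| ^ ν := by
          refine Real.rpow_le_rpow (abs_nonneg _) ?_ hν.le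
          rw [abs_of_neg (by linarith), abs_of_neg (by linarith)]
          linarith
        calc |g s - g t| ≤ |g s - g (x i)| + |g (x i) - g t| := abs_sub_le _ _ _
          _ ≤ C₀ * |s - t| ^ ν + C₀ * |s - t| ^ ν := by
            gcongr
            · exact h2.trans (by gcongr)
            · exact h3.trans (by gcongr)
          _ = (2 * C₀) * |s - t| ^ ν := by ring
      · refine (hfar s hs t ht ?_).trans ?_
        · have := hm_le (i + 1) hj
          rw [Nat.add_sub_cancel] at this
          rw [abs_sub_comm]
          exact le_trans (by linarith) (le_abs_self _)
        · gcongr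
          linarith
  refine ⟨2 * C₀, by positivity, fun s hs t ht => ?_⟩
  rcases le_total s t with h | h
  · exact hlt s t ⟨hs, ht, h⟩
  · rw [abs_sub_comm, abs_sub_comm s t]
    exact hlt t s ⟨ht, hs, h⟩

/-- If `Θ < 1`, `Ω > 1` and `Γ < 1`, then `f₁ ∈ Lip δ` with `δ = min (log α / log |I_min|, μ)`. -/
theorem chfif_theta_lt_one_omega_gt_one_gamma_lt_one
    (N : ℕ) (hN : 2 ≤ N)
    (x : ℕ → ℝ) (hx0 : x 0 = 0) (hxN : x N = 1)
    (hxmono : ∀ i < N, x i < x (i + 1))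
    (α β γ : ℕ → ℝ)
    (hα : ∀ i ∈ Set.Icc 1 N, |α i| < 1)
    (hβγ : ∀ i ∈ Set.Icc 1 N, |β i| + |γ i| < 1)
    (lam mu : ℕ → ℝ)
    (hlam : ∀ i ∈ Set.Icc 1 N, lam i ∈ Set.Ioc (0 : ℝ) 1)
    (hmu : ∀ i ∈ Set.Icc 1 N, mu i ∈ Set.Ioc (0 : ℝ) 1)
    (p q : ℕ → ℝ → ℝ)
    (hp : ∀ i ∈ Set.Icc 1 N, ∃ M > 0, ∀ s ∈ Set.Icc (0 : ℝ) 1, ∀ t ∈ Set.Icc (0 : ℝ) 1,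
      |p i s - p i t| ≤ M * |s - t| ^ lam i)
    (hq : ∀ i ∈ Set.Icc 1 N, ∃ M > 0, ∀ s ∈ Set.Icc (0 : ℝ) 1, ∀ t ∈ Set.Icc (0 : ℝ) 1,
      |q i s - q i t| ≤ M * |s - t| ^ mu i)
    (f₁ f₂ : ℝ → ℝ)
    (hf₁c : ContinuousOn f₁ (Set.Icc 0 1)) (hf₂c : ContinuousOn f₂ (Set.Icc 0 1))
    (heq₁ : ∀ i ∈ Set.Icc 1 N, ∀ t ∈ Set.Icc (0 : ℝ) 1,
      f₁ ((x i - x (i - 1)) * t + x (i - 1)) = α i * f₁ t + β i * f₂ t + p i t)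
    (heq₂ : ∀ i ∈ Set.Icc 1 N, ∀ t ∈ Set.Icc (0 : ℝ) 1,
      f₂ ((x i - x (i - 1)) * t + x (i - 1)) = γ i * f₂ t + q i t)
    (hΘ : maxOver N (fun i => |α i| / (x i - x (i - 1)) ^ minOver N mu) < 1)
    (hΩ : 1 < maxOver N (fun i => |α i| / (x i - x (i - 1)) ^ minOver N lam))
    (hΓ : maxOver N (fun i => |γ i| / (x i - x (i - 1)) ^ minOver N mu) < 1)
    :
    ∃ C > 0, ∀ s ∈ Set.Icc (0 : ℝ) 1, ∀ t ∈ Set.Icc (0 : ℝ) 1,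
      |f₁ s - f₁ t| ≤ C * |s - t| ^ (min (Real.log (maxOver N (fun i => |α i|)) / Real.log (minOver N (fun i => x i - x (i - 1)))) (minOver N mu)) := by
  have hN1 : 1 ≤ N := by omega
  have hlen : ∀ i ∈ Set.Icc 1 N, 0 < x i - x (i - 1) := by
    rintro i ⟨h1, h2⟩
    have := hxmono (i - 1) (by omega)
    rw [Nat.sub_add_cancel h1] at this
    linarith
  have hlen1 : ∀ i ∈ Set.Icc 1 N, x i - x (i - 1) ≤ 1 := by
    have hmono : ∀ d i, i + d ≤ N → x i ≤ x (i + d) := by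
      intro d
      induction d with
      | zero => intro i _; exact le_rfl
      | succ d ih =>
        intro i h
        exact (ih i (by omega)).trans (hxmono (i + d) (by omega)).le
    rintro i ⟨h1, h2⟩
    have h3 := hmono (i - 1) 0 (by omega)
    have h4 := hmono (N - i) i (by omega)
    rw [Nat.add_sub_cancel' h2] at h4
    rw [Nat.zero_add] at h3
    linarith
  set μ := minOver N mu with hμ_def
  have hμ : 0 < μ := by
    obtain ⟨i, hi, h⟩ := exists_eq_minOver hN1 mu
    rw [hμ_def, h]
    exact (hmu i hi).1
  have hμlam : μ ≤ minOver N lam := by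
    by_contra! hcon
    obtain ⟨i, hi, h⟩ := exists_eq_maxOver hN1
      (fun i => |α i| / (x i - x (i - 1)) ^ minOver N lam)
    have h1 := (le_maxOver (fun i => |α i| / (x i - x (i - 1)) ^ μ) hi).trans_lt hΘ
    rw [h] at hΩ
    have h2 : |α i| / (x i - x (i - 1)) ^ minOver N lam ≤ |α i| / (x i - x (i - 1)) ^ μ :=
      div_le_div_of_nonneg_left (abs_nonneg _) (Real.rpow_pos_of_pos (hlen i hi) _)
        (Real.rpow_le_rpow_of_exponent_ge (hlen i hi) (hlen1 i hi) hcon.le)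
    linarith
  have hexp : ∀ s ∈ Set.Icc (0 : ℝ) 1, ∀ t ∈ Set.Icc (0 : ℝ) 1, s ≠ t → ∀ a b : ℝ, b ≤ a →
      |s - t| ^ a ≤ |s - t| ^ b := by
    intro s hs t ht hne a b hab
    refine Real.rpow_le_rpow_of_exponent_ge (abs_pos.mpr (sub_ne_zero.mpr hne)) ?_ hab
    rw [abs_le]
    constructor <;> linarith [hs.1, hs.2, ht.1, ht.2]
  obtain ⟨C₂, hC₂, hf₂⟩ := holder_of_self_affine hN hx0 hxN hxmono hμ
    (fun i hi => by
      obtain ⟨M, hM, h⟩ := hq i hi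
      refine ⟨M, hM, fun s hs t ht => ?_⟩
      rcases eq_or_ne s t with rfl | hne
      · rw [sub_self (q i s), abs_zero]
        positivity
      · exact (h s hs t ht).trans
          (mul_le_mul_of_nonneg_left (hexp s hs t ht hne _ _ (minOver_le mu hi)) hM.le))
    hf₂c heq₂ hΓ
  obtain ⟨C₁, hC₁, hf₁⟩ := holder_of_self_affine (r := fun i t => β i * f₂ t + p i t)
    hN hx0 hxN hxmono hμ
    (fun i hi => by
      obtain ⟨M, hM, h⟩ := hp i hi
      refine ⟨|β i| * C₂ + M, by positivity, fun s hs t ht => ?_⟩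
      rcases eq_or_ne s t with rfl | hne
      · rw [sub_self (β i * f₂ s + p i s), abs_zero]
        positivity
      · calc |β i * f₂ s + p i s - (β i * f₂ t + p i t)|
            = |β i * (f₂ s - f₂ t) + (p i s - p i t)| := by congr 1; ring
          _ ≤ |β i| * |f₂ s - f₂ t| + |p i s - p i t| := by
            rw [← abs_mul]; exact abs_add_le _ _
          _ ≤ |β i| * (C₂ * |s - t| ^ μ) + M * |s - t| ^ μ := by
            refine add_le_add (mul_le_mul_of_nonneg_left (hf₂ s hs t ht) (abs_nonneg _))
              ((h s hs t ht).trans (mul_le_mul_of_nonneg_left ?_ hM.le))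
            exact hexp s hs t ht hne _ _ (hμlam.trans (minOver_le lam hi))
          _ = (|β i| * C₂ + M) * |s - t| ^ μ := by ring)
    hf₁c (fun i hi t ht => by rw [heq₁ i hi t ht, add_assoc]) hΘ
  refine ⟨C₁, hC₁, fun s hs t ht => ?_⟩
  rcases eq_or_ne s t with rfl | hne
  · rw [sub_self (f₁ s), abs_zero]
    positivity
  · exact (hf₁ s hs t ht).trans
      (mul_le_mul_of_nonneg_left (hexp s hs t ht hne _ _ (min_le_right _ _)) hC₁.le)
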